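/- arXiv:2404.13169 — 4 statements merged into one kernel-verified Lean document; each statement's English description precedes it below -/
import Mathlib

section
/- Let M be a monoid equipped with a uniformity and let 𝒮 and 𝒥 be arbitrary families of subsets of M. Then the forgetful functor from the category of (𝒮,𝒥)-constrained M-flows on uniform spaces to the category Unif of uniform spaces with uniformly continuous maps is monadic. -/
open CategoryTheory

universe u

/-- A functor is *monadic* if it is, up to an equivalence commuting with the forgetful
functors, the forgetful functor from the Eilenberg–Moore category of algebras of a monad
on its codomain. -/
def IsMonadicFunctor {A : Type*} [Category A] {B : Type*} [Category B] (U : A ⥤ B) : Prop :=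
  ∃ (T : Monad B) (e : A ≌ T.Algebra), Nonempty (e.functor ⋙ T.forget ≅ U)

/-- An `(𝒮,𝒥)`-constrained `M`-flow on a uniform space: a unital associative action of `M`
by uniformly continuous maps which is separately uniformly continuous over `S × X` for every
`S ∈ 𝒮` and jointly uniformly continuous over `J × X` (with the product uniformity) for
every `J ∈ 𝒥`. -/
structure ConstrainedUnifFlow (M : Type u) [Monoid M] [UniformSpace M]
    (𝒮 𝒥 : Set (Set M)) : Type (u + 1) where
  carrier : Type u
  [uniformity : UniformSpace carrier]
  act : M → carrier → carrier
  one_act : ∀ x, act 1 x = x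
  mul_act : ∀ m n x, act (m * n) x = act m (act n x)
  uniformContinuous_act : ∀ m : M, UniformContinuous (act m)
  sep_uniformContinuous : ∀ S ∈ 𝒮, ∀ x : carrier, UniformContinuousOn (fun m => act m x) S
  joint_uniformContinuous : ∀ J ∈ 𝒥,
    UniformContinuousOn (fun p : M × carrier => act p.1 p.2) (J ×ˢ (Set.univ : Set carrier))

attribute [instance] ConstrainedUnifFlow.uniformity

/-- Morphisms of constrained flows on uniform spaces: uniformly continuous `M`-equivariant
maps. -/
instance ConstrainedUnifFlow.category (M : Type u) [Monoid M] [UniformSpace M]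
    (𝒮 𝒥 : Set (Set M)) : Category (ConstrainedUnifFlow M 𝒮 𝒥) where
  Hom X Y := { f : X.carrier → Y.carrier //
    UniformContinuous f ∧ ∀ (m : M) (x : X.carrier), f (X.act m x) = Y.act m (f x) }
  id X := ⟨id, uniformContinuous_id, fun _ _ => rfl⟩
  comp f g := ⟨g.1 ∘ f.1, g.2.1.comp f.2.1, fun m x => by
    simp only [Function.comp_apply, f.2.2, g.2.2]⟩
  id_comp _ := Subtype.ext rfl
  comp_id _ := Subtype.ext rfl
  assoc _ _ _ := Subtype.ext rfl

/-- The forgetful functor from `(𝒮,𝒥)`-constrained `M`-flows on uniform spaces to the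
category `Unif` of uniform spaces with uniformly continuous maps. -/
def unifFlowForget (M : Type u) [Monoid M] [UniformSpace M] (𝒮 𝒥 : Set (Set M)) :
    ConstrainedUnifFlow M 𝒮 𝒥 ⥤ UniformSpaceCat.{u} where
  obj X := UniformSpaceCat.of X.carrier
  map f := ⟨f.1, f.2.1⟩
  map_id _ := rfl
  map_comp _ _ := rfl

theorem UniformContinuousOn.comp_uniformContinuous {α β γ : Type*} [UniformSpace α]
    [UniformSpace β] [UniformSpace γ] {g : β → γ} {f : α → β} {s : Set α} {t : Set β}
    (hg : UniformContinuousOn g t) (hf : UniformContinuous f) (hst : Set.MapsTo f s t) :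
    UniformContinuousOn (g ∘ f) s := by
  rw [uniformContinuousOn_iff_restrict] at hg ⊢
  exact hg.comp ((hf.comp uniformContinuous_subtype_val).subtype_mk fun x => hst x.2)

theorem UniformContinuous.comp_uniformContinuousOn' {α β γ : Type*} [UniformSpace α]
    [UniformSpace β] [UniformSpace γ] {g : β → γ} {f : α → β} {s : Set α}
    (hg : UniformContinuous g) (hf : UniformContinuousOn f s) :
    UniformContinuousOn (g ∘ f) s :=
  Filter.Tendsto.comp hg hf

theorem uniformContinuousOn_comap_rng {α β γ : Type*} [UniformSpace α] [v : UniformSpace γ]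
    {g : β → γ} {f : α → β} {s : Set α} (h : UniformContinuousOn (g ∘ f) s) :
    @UniformContinuousOn α β _ (UniformSpace.comap g v) f s :=
  Filter.tendsto_comap_iff.2 h

theorem uniformContinuousOn_sInf_rng {α β : Type*} [UniformSpace α] {us : Set (UniformSpace β)}
    {f : α → β} {s : Set α} (h : ∀ u ∈ us, @UniformContinuousOn α β _ u f s) :
    @UniformContinuousOn α β _ (sInf us) f s := by
  simp only [uniformContinuousOn_iff_restrict] at h ⊢
  exact uniformContinuous_sInf_rng.2 h

section FreeFlow

open scoped Uniformity Topology

variable {M : Type u} [Monoid M] [UniformSpace M] {𝒮 𝒥 : Set (Set M)}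

/-- A uniformity on `M × X` is *flow-compatible* if left translation makes `M × X` a constrained
flow and `x ↦ (1, x)` is uniformly continuous. -/
structure IsFlowCompatible (𝒮 𝒥 : Set (Set M)) (X : Type u) [UniformSpace X]
    (u : UniformSpace (M × X)) : Prop where
  incl : UniformContinuous[_, u] (fun x : X => ((1 : M), x))
  act : ∀ m : M, UniformContinuous[u, u] (fun p : M × X => (m * p.1, p.2))
  sep : ∀ S ∈ 𝒮, ∀ p : M × X, @UniformContinuousOn _ _ _ u (fun m : M => (m * p.1, p.2)) S
  joint : ∀ J ∈ 𝒥, @UniformContinuousOn _ _ (@instUniformSpaceProd M (M × X) _ u) u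
    (fun q : M × (M × X) => (q.1 * q.2.1, q.2.2)) (J ×ˢ Set.univ)

theorem isFlowCompatible_sInf (X : Type u) [UniformSpace X] {us : Set (UniformSpace (M × X))}
    (h : ∀ u ∈ us, IsFlowCompatible 𝒮 𝒥 X u) :
    IsFlowCompatible 𝒮 𝒥 X (sInf us) where
  incl := uniformContinuous_sInf_rng.2 fun u hu => (h u hu).incl
  act m := uniformContinuous_sInf_rng.2 fun u hu =>
    uniformContinuous_sInf_dom hu ((h u hu).act m)
  sep S hS p := uniformContinuousOn_sInf_rng fun u hu => (h u hu).sep S hS p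
  joint J hJ := by
    refine @uniformContinuousOn_sInf_rng _ _ (@instUniformSpaceProd _ _ _ (sInf us)) us _ _
      fun u hu => ?_
    exact @UniformContinuousOn.comp_uniformContinuous _ _ _
      (@instUniformSpaceProd _ _ _ (sInf us)) (@instUniformSpaceProd _ _ _ u) u _ (Prod.map id id)
      _ _ ((h u hu).joint J hJ)
      (@UniformContinuous.prodMap _ _ _ _ _ (sInf us) _ u _ _ uniformContinuous_id
        (uniformContinuous_sInf_dom (u₁ := us) (u₂ := u) hu (@uniformContinuous_id _ u)))
      fun _ hq => hq

/-- The action map `(m, x) ↦ m • h x` induces a flow-compatible uniformity on `M × X`. -/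
theorem IsFlowCompatible.comap {X : Type u} [UniformSpace X] (Y : ConstrainedUnifFlow M 𝒮 𝒥)
    {h : X → Y.carrier} (hh : UniformContinuous h) :
    IsFlowCompatible 𝒮 𝒥 X
      (UniformSpace.comap (fun p : M × X => Y.act p.1 (h p.2)) Y.uniformity) := by
  have hcomap := @uniformContinuous_comap _ _ (fun p : M × X => Y.act p.1 (h p.2)) Y.uniformity
  refine ⟨?_, fun m => ?_, fun S hS p => ?_, fun J hJ => ?_⟩
  · refine uniformContinuous_comap' ?_
    simpa only [Function.comp_def, Y.one_act] using hh
  · refine @uniformContinuous_comap' _ _ _ _ _ _ (_) ?_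
    simpa only [Function.comp_def, Y.mul_act] using
      @UniformContinuous.comp _ _ _ (_) _ _ _ _ (Y.uniformContinuous_act m) hcomap
  · refine uniformContinuousOn_comap_rng ?_
    simpa only [Function.comp_def, Y.mul_act] using
      Y.sep_uniformContinuous S hS (Y.act p.1 (h p.2))
  · let u := UniformSpace.comap (fun p : M × X => Y.act p.1 (h p.2)) Y.uniformity
    refine @uniformContinuousOn_comap_rng _ _ _ (@instUniformSpaceProd _ _ _ u) _ _ _ _ ?_
    simpa only [Function.comp_def, Y.mul_act, Prod.map_fst, Prod.map_snd, id] using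
      @UniformContinuousOn.comp_uniformContinuous _ _ _ (@instUniformSpaceProd _ _ _ u) _ _ _
        _ _ _ (Y.joint_uniformContinuous J hJ)
        (@UniformContinuous.prodMap _ _ _ _ _ u _ _ _ _ uniformContinuous_id hcomap)
        (fun q hq => ⟨hq.1, trivial⟩ : Set.MapsTo _ (J ×ˢ Set.univ) (J ×ˢ Set.univ))

/-- There is a finest flow-compatible uniformity on `M × X`. -/
theorem isFlowCompatible_free (𝒮 𝒥 : Set (Set M)) (X : Type u) [UniformSpace X] :
    IsFlowCompatible 𝒮 𝒥 X (sInf {u | IsFlowCompatible 𝒮 𝒥 X u}) :=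
  isFlowCompatible_sInf X fun _ h => h

/-- The free constrained flow on a uniform space `X`: the set `M × X` with the finest
flow-compatible uniformity. -/
def freeConstrainedUnifFlow (𝒮 𝒥 : Set (Set M)) (X : UniformSpaceCat.{u}) :
    ConstrainedUnifFlow M 𝒮 𝒥 where
  carrier := M × X
  uniformity := sInf {u | IsFlowCompatible 𝒮 𝒥 X u}
  act m p := (m * p.1, p.2)
  one_act p := by simp
  mul_act m n p := by simp [mul_assoc]
  uniformContinuous_act := (isFlowCompatible_free 𝒮 𝒥 X).act
  sep_uniformContinuous := (isFlowCompatible_free 𝒮 𝒥 X).sep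
  joint_uniformContinuous := (isFlowCompatible_free 𝒮 𝒥 X).joint

/-- The universal property of the free constrained flow. -/
def freeConstrainedUnifFlowHomEquiv (X : UniformSpaceCat.{u}) (Y : ConstrainedUnifFlow M 𝒮 𝒥) :
    (freeConstrainedUnifFlow 𝒮 𝒥 X ⟶ Y) ≃ (X ⟶ (unifFlowForget M 𝒮 𝒥).obj Y) where
  toFun f := ⟨fun x => f.1 ((1 : M), x), f.2.1.comp
    (isFlowCompatible_free 𝒮 𝒥 X).incl⟩
  invFun h := ⟨fun p => Y.act p.1 (h.hom'.1 p.2),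
    uniformContinuous_sInf_dom (IsFlowCompatible.comap Y h.hom'.2) uniformContinuous_comap,
    fun m p => Y.mul_act m p.1 _⟩
  left_inv f := Subtype.ext <| funext fun p => by
    refine (f.2.2 p.1 ((1 : M), p.2)).symm.trans (congrArg f.1 ?_)
    exact Prod.ext (mul_one _) rfl
  right_inv h := UniformSpaceCat.hom_ext <| funext fun x => Y.one_act _

/-- The free constrained flow functor is left adjoint to the forgetful functor. -/
def freeConstrainedUnifFlowAdj (M : Type u) [Monoid M] [UniformSpace M] (𝒮 𝒥 : Set (Set M)) :
    Adjunction.leftAdjointOfEquiv (G := unifFlowForget M 𝒮 𝒥)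
      freeConstrainedUnifFlowHomEquiv (fun _ _ _ _ _ => rfl) ⊣ unifFlowForget M 𝒮 𝒥 :=
  Adjunction.adjunctionOfEquivLeft freeConstrainedUnifFlowHomEquiv fun _ _ _ _ _ => rfl

instance : (unifFlowForget M 𝒮 𝒥).Faithful where
  map_injective h := Subtype.ext <| congrArg (fun k => k.hom'.1) h

theorem freeConstrainedUnifFlowAdj_toMonad_map {X Y : UniformSpaceCat.{u}} (f : X ⟶ Y)
    (p : M × X) :
    ((freeConstrainedUnifFlowAdj M 𝒮 𝒥).toMonad.map f).hom'.1 p = (p.1, f.hom'.1 p.2) :=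
  Prod.ext (mul_one p.1) rfl

instance : (Monad.comparison (freeConstrainedUnifFlowAdj M 𝒮 𝒥)).Full where
  map_surjective {X Y} f := by
    refine ⟨⟨f.f.hom'.1, f.f.hom'.2, fun m x => ?_⟩, rfl⟩
    exact (congrArg (fun k => k.hom'.1 (m, x)) f.h).symm.trans
      (congrArg (fun p : M × Y.carrier => Y.act p.1 p.2)
        (freeConstrainedUnifFlowAdj_toMonad_map f.f (m, x)))

/-- The constrained flow underlying an algebra for the free flow monad. -/
def flowOfAlgebra (A : (freeConstrainedUnifFlowAdj M 𝒮 𝒥).toMonad.Algebra) :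
    ConstrainedUnifFlow M 𝒮 𝒥 where
  carrier := A.A
  act m x := A.a.hom'.1 (m, x)
  one_act x := congrArg (fun k => k.hom'.1 x) A.unit
  mul_act m n x := (congrArg (fun k => k.hom'.1 (m, (n, x))) A.assoc).trans
    (congrArg A.a.hom'.1 (freeConstrainedUnifFlowAdj_toMonad_map A.a (m, (n, x))))
  uniformContinuous_act m := by
    have hF := isFlowCompatible_free 𝒮 𝒥 A.A
    have h : UniformContinuous fun x : A.A =>
        A.a.hom'.1 ((freeConstrainedUnifFlow 𝒮 𝒥 A.A).act m ((1 : M), x)) :=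
      A.a.hom'.2.comp
        (((freeConstrainedUnifFlow 𝒮 𝒥 A.A).uniformContinuous_act m).comp hF.incl)
    simpa only [freeConstrainedUnifFlow, mul_one] using h
  sep_uniformContinuous S hS x := by
    have h : UniformContinuousOn (fun m : M =>
        A.a.hom'.1 ((freeConstrainedUnifFlow 𝒮 𝒥 A.A).act m ((1 : M), x))) S :=
      A.a.hom'.2.comp_uniformContinuousOn'
        ((freeConstrainedUnifFlow 𝒮 𝒥 A.A).sep_uniformContinuous S hS _)
    simpa only [freeConstrainedUnifFlow, mul_one] using h
  joint_uniformContinuous J hJ := by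
    have hF := isFlowCompatible_free 𝒮 𝒥 A.A
    have h : UniformContinuousOn (fun p : M × A.A =>
        A.a.hom'.1 ((freeConstrainedUnifFlow 𝒮 𝒥 A.A).act p.1 ((1 : M), p.2)))
        (J ×ˢ Set.univ) :=
      A.a.hom'.2.comp_uniformContinuousOn'
        (((freeConstrainedUnifFlow 𝒮 𝒥 A.A).joint_uniformContinuous J hJ).comp_uniformContinuous
          (uniformContinuous_id.prodMap hF.incl) fun _ hp => ⟨hp.1, trivial⟩)
    simpa only [freeConstrainedUnifFlow, mul_one] using h

instance : (Monad.comparison (freeConstrainedUnifFlowAdj M 𝒮 𝒥)).EssSurj where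
  mem_essImage A := by
    refine ⟨flowOfAlgebra A, ⟨Monad.Algebra.isoMk (Iso.refl _) ?_⟩⟩
    exact UniformSpaceCat.hom_ext <| funext fun p =>
      congrArg A.a.hom'.1 (freeConstrainedUnifFlowAdj_toMonad_map (𝟙 A.A) p)

end FreeFlow

/-- For a monoid `M` equipped with a uniformity and arbitrary families `𝒮`, `𝒥` of subsets
of `M`, the forgetful functor from `(𝒮,𝒥)`-constrained `M`-flows on uniform spaces to the
category of uniform spaces with uniformly continuous maps is monadic. -/
theorem forget_constrainedUnifFlow_isMonadic
    (M : Type u) [Monoid M] [UniformSpace M] (𝒮 𝒥 : Set (Set M)) :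
    IsMonadicFunctor (unifFlowForget M 𝒮 𝒥) := by
  let adj := freeConstrainedUnifFlowAdj M 𝒮 𝒥
  have : (Monad.comparison adj).IsEquivalence := { }
  exact ⟨adj.toMonad, (Monad.comparison adj).asEquivalence, ⟨Monad.comparisonForget adj⟩⟩
end

section
/- Let M be a topological monoid and let 𝒮 and 𝒥 be arbitrary families of subsets of M. Then the category of (𝒮,𝒥)-constrained M-flows on topological spaces is cocomplete, i.e. it admits all small colimits. -/
open CategoryTheory

universe u

/-- An `(𝒮,𝒥)`-constrained `M`-flow on a topological space: a unital associative action of `M`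
by continuous maps which is separately continuous over `S × X` for every `S ∈ 𝒮` and jointly
continuous over `J × X` for every `J ∈ 𝒥`. -/
structure ConstrainedFlow (M : Type u) [Monoid M] [TopologicalSpace M]
    (𝒮 𝒥 : Set (Set M)) : Type (u + 1) where
  carrier : Type u
  [topology : TopologicalSpace carrier]
  act : M → carrier → carrier
  one_act : ∀ x, act 1 x = x
  mul_act : ∀ m n x, act (m * n) x = act m (act n x)
  continuous_act : ∀ m : M, Continuous (act m)
  sep_continuous : ∀ S ∈ 𝒮, ∀ x : carrier, ContinuousOn (fun m => act m x) S
  joint_continuous : ∀ J ∈ 𝒥,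
    ContinuousOn (fun p : M × carrier => act p.1 p.2) (J ×ˢ (Set.univ : Set carrier))

attribute [instance] ConstrainedFlow.topology

/-- Morphisms of constrained flows: continuous `M`-equivariant maps. -/
instance ConstrainedFlow.category (M : Type u) [Monoid M] [TopologicalSpace M]
    (𝒮 𝒥 : Set (Set M)) : Category (ConstrainedFlow M 𝒮 𝒥) where
  Hom X Y := { f : X.carrier → Y.carrier //
    Continuous f ∧ ∀ (m : M) (x : X.carrier), f (X.act m x) = Y.act m (f x) }
  id X := ⟨id, continuous_id, fun _ _ => rfl⟩
  comp f g := ⟨g.1 ∘ f.1, g.2.1.comp f.2.1, fun m x => by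
    simp only [Function.comp_apply, f.2.2, g.2.2]⟩
  id_comp _ := Subtype.ext rfl
  comp_id _ := Subtype.ext rfl
  assoc _ _ _ := Subtype.ext rfl

namespace ConstrainedFlow

open Limits Topology

variable {M : Type u} [TopologicalSpace M] {𝒮 𝒥 : Set (Set M)}

/-- The topology `t` satisfies the continuity requirements of an `(𝒮,𝒥)`-constrained flow for the
operation `act`. -/
structure IsFlowTopology (𝒮 𝒥 : Set (Set M)) {Y : Type u} (act : M → Y → Y)
    (t : TopologicalSpace Y) : Prop where
  continuous_act : ∀ m : M, Continuous (act m)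
  sep_continuous : ∀ S ∈ 𝒮, ∀ x : Y, ContinuousOn (fun m => act m x) S
  joint_continuous : ∀ J ∈ 𝒥,
    ContinuousOn (fun p : M × Y => act p.1 p.2) (J ×ˢ (Set.univ : Set Y))

theorem continuousOn_sInf_rng {X Y : Type*} [TopologicalSpace X] {T : Set (TopologicalSpace Y)}
    {f : X → Y} {s : Set X} :
    @ContinuousOn _ _ _ (sInf T) f s ↔ ∀ t ∈ T, @ContinuousOn _ _ _ t f s := by
  simp only [continuousOn_iff_continuous_domRestrict]
  exact continuous_sInf_rng

/-- Flow topologies are closed under suprema of topologies (infima in the order used here). -/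
theorem isFlowTopology_sInf {Y : Type u} {act : M → Y → Y} {T : Set (TopologicalSpace Y)}
    (h : ∀ t ∈ T, IsFlowTopology 𝒮 𝒥 act t) : IsFlowTopology 𝒮 𝒥 act (sInf T) where
  continuous_act m := continuous_sInf_rng.2 fun t ht =>
    continuous_sInf_dom ht ((h t ht).continuous_act m)
  sep_continuous S hS x := continuousOn_sInf_rng.2 fun t ht => (h t ht).sep_continuous S hS x
  joint_continuous J hJ := by
    let := sInf T
    refine continuousOn_sInf_rng.2 fun t ht => ?_
    have hle : @instTopologicalSpaceProd M Y _ (sInf T) ≤ @instTopologicalSpaceProd M Y _ t :=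
      inf_le_inf_left _ (induced_mono (sInf_le ht))
    exact ((h t ht).joint_continuous J hJ).mono_dom hle

/-- The topology induced by an equivariant map to a constrained flow is a flow topology. -/
theorem isFlowTopology_induced [Monoid M] {Y : Type u} {act : M → Y → Y}
    (Z : ConstrainedFlow M 𝒮 𝒥) (f : Y → Z.carrier) (hf : ∀ m y, f (act m y) = Z.act m (f y)) :
    IsFlowTopology 𝒮 𝒥 act (Z.topology.induced f) := by
  let := Z.topology.induced f
  have hi : IsInducing f := ⟨rfl⟩
  refine ⟨fun m => ?_, fun S hS x => ?_, fun J hJ => ?_⟩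
  · rw [hi.continuous_iff]
    exact ((Z.continuous_act m).comp hi.continuous).congr fun y => (hf m y).symm
  · rw [hi.continuousOn_iff]
    exact (Z.sep_continuous S hS (f x)).congr fun m _ => hf m x
  · rw [hi.continuousOn_iff]
    exact ((Z.joint_continuous J hJ).comp
      (continuous_id.prodMap hi.continuous).continuousOn fun p hp => ⟨hp.1, trivial⟩).congr
      fun p _ => hf p.1 p.2

variable [Monoid M] {K : Type u} [SmallCategory K] (F : K ⥤ ConstrainedFlow M 𝒮 𝒥)

/-- The relation whose quotient is the colimit of the underlying sets. -/
inductive ColimitRel : (Σ j, (F.obj j).carrier) → (Σ j, (F.obj j).carrier) → Prop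
  | map {i j : K} (f : i ⟶ j) (x : (F.obj i).carrier) : ColimitRel ⟨i, x⟩ ⟨j, (F.map f).1 x⟩

/-- The colimit of the underlying sets. -/
def ColimitCarrier : Type u := Quot (ColimitRel F)

/-- The coprojections to the colimit of the underlying sets. -/
def colimitIncl (j : K) (x : (F.obj j).carrier) : ColimitCarrier F := Quot.mk _ ⟨j, x⟩

theorem colimitIncl_map {i j : K} (f : i ⟶ j) (x : (F.obj i).carrier) :
    colimitIncl F j ((F.map f).1 x) = colimitIncl F i x :=
  (Quot.sound (.map f x)).symm

theorem exists_colimitIncl_eq (y : ColimitCarrier F) : ∃ j x, colimitIncl F j x = y := by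
  obtain ⟨⟨j, x⟩, rfl⟩ := Quot.exists_rep y
  exact ⟨j, x, rfl⟩

/-- The induced action on the colimit of the underlying sets. -/
def colimitAct (m : M) : ColimitCarrier F → ColimitCarrier F :=
  Quot.lift (fun a => colimitIncl F a.1 ((F.obj a.1).act m a.2)) <| by
    rintro _ _ ⟨f, x⟩
    exact (colimitIncl_map F f _).symm.trans (congrArg _ ((F.map f).2.2 m x))

theorem colimitAct_incl (m : M) (j : K) (x : (F.obj j).carrier) :
    colimitAct F m (colimitIncl F j x) = colimitIncl F j ((F.obj j).act m x) := rfl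

/-- The flow topologies on the colimit of the underlying sets for which the coprojections are
continuous. -/
def colimitTopologies : Set (TopologicalSpace (ColimitCarrier F)) :=
  {t | IsFlowTopology 𝒮 𝒥 (colimitAct F) t ∧ ∀ j, Continuous[_, t] (colimitIncl F j)}

theorem isFlowTopology_colimit :
    IsFlowTopology 𝒮 𝒥 (colimitAct F) (sInf (colimitTopologies F)) :=
  isFlowTopology_sInf fun _ ht => ht.1

/-- The colimit flow: the colimit of the underlying sets, with the finest flow topology for which
the coprojections are continuous. -/
def colimitFlow : ConstrainedFlow M 𝒮 𝒥 where
  carrier := ColimitCarrier F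
  topology := sInf (colimitTopologies F)
  act := colimitAct F
  one_act y := by
    obtain ⟨j, x, rfl⟩ := exists_colimitIncl_eq F y
    rw [colimitAct_incl, one_act]
  mul_act m n y := by
    obtain ⟨j, x, rfl⟩ := exists_colimitIncl_eq F y
    simp only [colimitAct_incl, mul_act]
  continuous_act := (isFlowTopology_colimit F).continuous_act
  sep_continuous := (isFlowTopology_colimit F).sep_continuous
  joint_continuous := (isFlowTopology_colimit F).joint_continuous

/-- The cocone with point the colimit flow. -/
def colimitCocone : Cocone F where
  pt := colimitFlow F
  ι :=
    { app := fun j => ⟨colimitIncl F j, continuous_sInf_rng.2 fun _ ht => ht.2 j, fun _ _ => rfl⟩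
      naturality := fun _ _ f => Subtype.ext <| funext fun x => colimitIncl_map F f x }

/-- The map of sets from the colimit induced by a cocone. -/
def colimitDesc (s : Cocone F) : ColimitCarrier F → s.pt.carrier :=
  Quot.lift (fun a => (s.ι.app a.1).1 a.2) <| by
    rintro _ _ ⟨f, x⟩
    exact (congrFun (congrArg Subtype.val (s.w f)) x).symm

theorem colimitDesc_act (s : Cocone F) (m : M) (y : ColimitCarrier F) :
    colimitDesc F s (colimitAct F m y) = s.pt.act m (colimitDesc F s y) := by
  obtain ⟨j, x, rfl⟩ := exists_colimitIncl_eq F y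
  exact (s.ι.app j).2.2 m x

theorem continuous_colimitDesc (s : Cocone F) :
    Continuous[sInf (colimitTopologies F), _] (colimitDesc F s) :=
  continuous_iff_le_induced.2 <| sInf_le
    ⟨isFlowTopology_induced s.pt _ (colimitDesc_act F s),
      fun j => continuous_induced_rng.2 (s.ι.app j).2.1⟩

/-- The colimit flow is a colimit. -/
def colimitCoconeIsColimit : IsColimit (colimitCocone F) where
  desc s := ⟨colimitDesc F s, continuous_colimitDesc F s, colimitDesc_act F s⟩
  fac _ _ := rfl
  uniq s g hg := Subtype.ext <| funext fun y => by
    obtain ⟨j, x, rfl⟩ := exists_colimitIncl_eq F y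
    exact congrFun (congrArg Subtype.val (hg j)) x

end ConstrainedFlow

/-- For a topological monoid `M` and arbitrary families `𝒮`, `𝒥` of subsets of `M`, the
category of `(𝒮,𝒥)`-constrained `M`-flows on topological spaces is cocomplete: it admits
all small colimits. -/
theorem constrainedFlow_hasColimits
    (M : Type u) [Monoid M] [TopologicalSpace M] [ContinuousMul M] (𝒮 𝒥 : Set (Set M)) :
    Limits.HasColimits (ConstrainedFlow M 𝒮 𝒥) := by
  exact ⟨fun _ _ => ⟨fun F => ⟨⟨⟨ConstrainedFlow.colimitCocone F,
    ConstrainedFlow.colimitCoconeIsColimit F⟩⟩⟩⟩⟩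
end

section
/- Let M be a topological monoid and let 𝒮 and 𝒥 be arbitrary families of subsets of M. Then the category of (𝒮,𝒥)-constrained M-flows on compact Hausdorff spaces is cocomplete, i.e. it admits all small colimits. -/
open CategoryTheory

universe u

/-- An `(𝒮,𝒥)`-constrained `M`-flow on a compact Hausdorff space: a unital associative
action of `M` by continuous maps on a compact Hausdorff space which is separately continuous
over `S × X` for every `S ∈ 𝒮` and jointly continuous over `J × X` for every `J ∈ 𝒥`.
Note that `M` itself need not be compact. -/
structure ConstrainedFlowCH (M : Type u) [Monoid M] [TopologicalSpace M]
    (𝒮 𝒥 : Set (Set M)) : Type (u + 1) where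
  carrier : Type u
  [topology : TopologicalSpace carrier]
  [cpct : CompactSpace carrier]
  [t2 : T2Space carrier]
  act : M → carrier → carrier
  one_act : ∀ x, act 1 x = x
  mul_act : ∀ m n x, act (m * n) x = act m (act n x)
  continuous_act : ∀ m : M, Continuous (act m)
  sep_continuous : ∀ S ∈ 𝒮, ∀ x : carrier, ContinuousOn (fun m => act m x) S
  joint_continuous : ∀ J ∈ 𝒥,
    ContinuousOn (fun p : M × carrier => act p.1 p.2) (J ×ˢ (Set.univ : Set carrier))

attribute [instance] ConstrainedFlowCH.topology ConstrainedFlowCH.cpct ConstrainedFlowCH.t2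

/-- Morphisms of constrained flows: continuous `M`-equivariant maps. -/
instance ConstrainedFlowCH.category (M : Type u) [Monoid M] [TopologicalSpace M]
    (𝒮 𝒥 : Set (Set M)) : Category (ConstrainedFlowCH M 𝒮 𝒥) where
  Hom X Y := { f : X.carrier → Y.carrier //
    Continuous f ∧ ∀ (m : M) (x : X.carrier), f (X.act m x) = Y.act m (f x) }
  id X := ⟨id, continuous_id, fun _ _ => rfl⟩
  comp f g := ⟨g.1 ∘ f.1, g.2.1.comp f.2.1, fun m x => by
    simp only [Function.comp_apply, f.2.2, g.2.2]⟩
  id_comp _ := Subtype.ext rfl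
  comp_id _ := Subtype.ext rfl
  assoc _ _ _ := Subtype.ext rfl

namespace ConstrainedFlowCH

open Limits Topology

variable {M : Type u} [Monoid M] [TopologicalSpace M] {𝒮 𝒥 : Set (Set M)}
  {J : Type u} [Category.{u} J] (F : J ⥤ ConstrainedFlowCH M 𝒮 𝒥)

/-- The disjoint union of the underlying sets of a diagram of flows. -/
abbrev Points : Type u := Σ j, (F.obj j).carrier

variable {F}

/-- The action on the disjoint union of a diagram of flows. -/
def pointsAct (m : M) (x : Points F) : Points F := ⟨x.1, (F.obj x.1).act m x.2⟩

/-- The map from the disjoint union of a diagram to the point of a cocone. -/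
def pointsDesc (s : Cocone F) (x : Points F) : s.pt.carrier := (s.ι.app x.1).1 x.2

lemma pointsDesc_act (s : Cocone F) (m : M) (x : Points F) :
    pointsDesc s (pointsAct m x) = s.pt.act m (pointsDesc s x) :=
  (s.ι.app x.1).2.2 m x.2

/-- The extension of `pointsDesc` to the Stone–Čech compactification of the discrete union. -/
noncomputable def ultrafilterDesc (s : Cocone F) : Ultrafilter (Points F) → s.pt.carrier :=
  Ultrafilter.extend (pointsDesc s)

lemma continuous_ultrafilterDesc (s : Cocone F) : Continuous (ultrafilterDesc s) :=
  continuous_ultrafilter_extend _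

lemma ultrafilterDesc_pure (s : Cocone F) (x : Points F) :
    ultrafilterDesc s (pure x) = pointsDesc s x :=
  (ultrafilter_extend_eq_iff).2 (by simp)

lemma ultrafilterDesc_map (s : Cocone F) (m : M) (p : Ultrafilter (Points F)) :
    ultrafilterDesc s (p.map (pointsAct m)) = s.pt.act m (ultrafilterDesc s p) := by
  have h : Filter.Tendsto (pointsDesc s) p (𝓝 (ultrafilterDesc s p)) :=
    (ultrafilter_extend_eq_iff (f := pointsDesc s)).1 rfl
  refine (ultrafilter_extend_eq_iff).2 ?_
  have h' := ((s.pt.continuous_act m).tendsto _).comp h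
  rw [Ultrafilter.map_map, Ultrafilter.coe_map]
  exact h'.congr fun x => (pointsDesc_act s m x).symm

variable (F) in
/-- Ultrafilters are identified when no cocone distinguishes them. -/
def colimitSetoid : Setoid (Ultrafilter (Points F)) where
  r p q := ∀ s : Cocone F, ultrafilterDesc s p = ultrafilterDesc s q
  iseqv := ⟨fun _ _ => rfl, fun h s => (h s).symm, fun h k s => (h s).trans (k s)⟩

variable (F) in
/-- The underlying set of the colimit of a diagram of flows. -/
def ColimitCarrier : Type u := Quotient (colimitSetoid F)

/-- The map from the colimit to the point of a cocone. -/
noncomputable def colimitDesc (s : Cocone F) : ColimitCarrier F → s.pt.carrier :=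
  Quotient.lift (ultrafilterDesc s) fun _ _ h => h s

/-- The quotient map from ultrafilters onto the colimit. -/
def colimitMk (p : Ultrafilter (Points F)) : ColimitCarrier F := Quotient.mk (colimitSetoid F) p

lemma colimitMk_surjective : Function.Surjective (colimitMk (F := F)) := Quotient.mk_surjective

lemma colimit_ext {x y : ColimitCarrier F} (h : ∀ s : Cocone F, colimitDesc s x = colimitDesc s y) :
    x = y := by
  induction x using Quotient.inductionOn
  induction y using Quotient.inductionOn
  exact Quotient.sound h

noncomputable instance : TopologicalSpace (ColimitCarrier F) :=
  ⨅ s : Cocone F, TopologicalSpace.induced (colimitDesc s) inferInstance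

lemma continuous_colimitDesc (s : Cocone F) : Continuous (colimitDesc s) :=
  continuous_iInf_dom (i := s) continuous_induced_dom

lemma continuousOn_colimit {X : Type*} [TopologicalSpace X] {f : X → ColimitCarrier F} {A : Set X}
    (h : ∀ s : Cocone F, ContinuousOn (fun x => colimitDesc s (f x)) A) : ContinuousOn f A := by
  rw [continuousOn_iff_continuous_domRestrict]
  exact continuous_iInf_rng.2 fun s => continuous_induced_rng.2
    (continuousOn_iff_continuous_domRestrict.1 (h s))

lemma continuous_colimit {X : Type*} [TopologicalSpace X] {f : X → ColimitCarrier F}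
    (h : ∀ s : Cocone F, Continuous fun x => colimitDesc s (f x)) : Continuous f :=
  continuous_iInf_rng.2 fun s => continuous_induced_rng.2 (h s)

lemma continuous_colimitMk : Continuous (colimitMk (F := F)) :=
  continuous_colimit continuous_ultrafilterDesc

instance : CompactSpace (ColimitCarrier F) :=
  colimitMk_surjective.compactSpace continuous_colimitMk

instance : T2Space (ColimitCarrier F) := by
  refine ⟨fun x y hxy => ?_⟩
  obtain ⟨s, hs⟩ : ∃ s : Cocone F, colimitDesc s x ≠ colimitDesc s y := by
    by_contra! h
    exact hxy (colimit_ext h)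
  exact separated_by_continuous (continuous_colimitDesc s) hs

/-- The action on the colimit of a diagram of flows. -/
def colimitAct (m : M) : ColimitCarrier F → ColimitCarrier F :=
  Quotient.map (Ultrafilter.map (pointsAct m)) fun p q h s => by
    rw [ultrafilterDesc_map, ultrafilterDesc_map, h s]

lemma colimitDesc_act (s : Cocone F) (m : M) (x : ColimitCarrier F) :
    colimitDesc s (colimitAct m x) = s.pt.act m (colimitDesc s x) := by
  obtain ⟨p, rfl⟩ := colimitMk_surjective x
  exact ultrafilterDesc_map s m p

variable (F) in
/-- The colimit of a diagram of flows. -/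
noncomputable def colimitFlow : ConstrainedFlowCH M 𝒮 𝒥 where
  carrier := ColimitCarrier F
  act := colimitAct
  one_act x := colimit_ext fun s => by rw [colimitDesc_act, s.pt.one_act]
  mul_act m n x := colimit_ext fun s => by simp only [colimitDesc_act, s.pt.mul_act]
  continuous_act m := continuous_colimit fun s => by
    simp only [colimitDesc_act]
    exact (s.pt.continuous_act m).comp (continuous_colimitDesc s)
  sep_continuous S hS x := continuousOn_colimit fun s => by
    simpa only [colimitDesc_act] using s.pt.sep_continuous S hS (colimitDesc s x)
  joint_continuous K hK := continuousOn_colimit fun s => by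
    simp only [colimitDesc_act]
    exact (s.pt.joint_continuous K hK).comp
      (continuous_id.prodMap (continuous_colimitDesc s)).continuousOn fun p hp => ⟨hp.1, trivial⟩

lemma colimitDesc_mk_pure (s : Cocone F) (j : J) (x : (F.obj j).carrier) :
    colimitDesc s (colimitMk (pure ⟨j, x⟩)) = (s.ι.app j).1 x :=
  ultrafilterDesc_pure s ⟨j, x⟩

variable (F) in
/-- The colimit cocone of a diagram of flows. -/
noncomputable def colimitCocone : Cocone F where
  pt := colimitFlow F
  ι :=
    { app := fun j => ⟨fun x => colimitMk (pure ⟨j, x⟩),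
        continuous_colimit fun s => by
          simpa only [colimitDesc_mk_pure] using (s.ι.app j).2.1,
        fun m x => colimit_ext fun s =>
          (colimitDesc_mk_pure s j _).trans <| ((s.ι.app j).2.2 m x).trans <| by
            rw [← colimitDesc_mk_pure]
            exact (colimitDesc_act s m _).symm⟩
      naturality := fun i j f => Subtype.ext <| funext fun x => colimit_ext fun s =>
        (colimitDesc_mk_pure s j _).trans <|
          (congrFun (congrArg Subtype.val (s.w f)) x).trans (colimitDesc_mk_pure s i x).symm }

variable (F) in
/-- The universal property of `colimitCocone`. -/
noncomputable def colimitCoconeIsColimit : IsColimit (colimitCocone F) where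
  desc s := ⟨colimitDesc s, continuous_colimitDesc s, fun m x => colimitDesc_act s m x⟩
  fac s j := Subtype.ext <| funext fun x => colimitDesc_mk_pure s j x
  uniq s g hg := by
    have key : g.1 ∘ colimitMk = ultrafilterDesc s :=
      denseRange_pure.equalizer (g.2.1.comp continuous_colimitMk) (continuous_ultrafilterDesc s) <|
        funext fun x => (congrFun (congrArg Subtype.val (hg x.1)) x.2).trans
          (ultrafilterDesc_pure s x).symm
    refine Subtype.ext (funext fun x => ?_)
    obtain ⟨p, rfl⟩ := colimitMk_surjective x
    exact congrFun key p

end ConstrainedFlowCH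

/-- For a topological monoid `M` and arbitrary families `𝒮`, `𝒥` of subsets of `M`, the
category of `(𝒮,𝒥)`-constrained `M`-flows on compact Hausdorff spaces is cocomplete: it
admits all small colimits. -/
theorem constrainedFlowCH_hasColimits
    (M : Type u) [Monoid M] [TopologicalSpace M] [ContinuousMul M] (𝒮 𝒥 : Set (Set M)) :
    Limits.HasColimits (ConstrainedFlowCH M 𝒮 𝒥) := by
  exact ⟨fun _ _ => ⟨fun F => ⟨⟨ConstrainedFlowCH.colimitCocone F,
    ConstrainedFlowCH.colimitCoconeIsColimit F⟩⟩⟩⟩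
end

section
/- Let M be a topological monoid, X a topological space, R an equivalence relation on X with quotient map q : X → X/R, and suppose that id_M × q : M × X → M × (X/R) is not a topological quotient map (equivalently, the quotient topology on M × (X/R) induced by id_M × q along the set-level identification is strictly finer than the product topology). Let Q denote the set M × (X/R) equipped with this quotient topology. Then the left translation action M × Q → Q sending (m, (n, x̄)) to (mn, x̄), where the domain M × Q carries the product topology, is not continuous. -/
universe u v

/-- Let `M` be a topological monoid, `X` a topological space and `R` an equivalence relation
on `X` such that `id_M × q : M × X → M × (X/R)` is not a topological quotient map (for the
product topologies).  Let `Q` be the set `M × (X/R)` with the quotient (coinduced) topology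
induced by `id_M × q`.  Then the left translation action `M × Q → Q`,
`(m, (n, x̄)) ↦ (m n, x̄)`, with the product topology on the domain `M × Q`, is not
continuous. -/
theorem translation_action_not_continuous_of_not_quotientMap
    {M : Type u} [Monoid M] [TopologicalSpace M] [ContinuousMul M]
    {X : Type v} [TopologicalSpace X] (R : Setoid X)
    (h : ¬ Topology.IsQuotientMap (Prod.map (id : M → M) (Quotient.mk R))) :
    letI tQ : TopologicalSpace (M × Quotient R) :=
      TopologicalSpace.coinduced (Prod.map (id : M → M) (Quotient.mk R)) inferInstance
    ¬ @Continuous (M × (M × Quotient R)) (M × Quotient R)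
        (@instTopologicalSpaceProd M (M × Quotient R) inferInstance tQ) tQ
        (fun p => (p.1 * p.2.1, p.2.2)) := by
  intro hact
  have hprod : Continuous (Prod.map (id : M → M) (Quotient.mk R)) :=
    continuous_id.prodMap continuous_quotient_mk'
  refine h ⟨⟨le_antisymm ?_ hprod.coinduced_le⟩,
    Function.surjective_id.prodMap Quotient.mk_surjective⟩
  rw [← continuous_id_iff_le]
  have hone : @Continuous (Quotient R) (M × Quotient R) _
      (TopologicalSpace.coinduced (Prod.map (id : M → M) (Quotient.mk R)) inferInstance)
      (fun x => (1, x)) :=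
    continuous_coinduced_dom.2 <| @Continuous.comp X (M × X) (M × Quotient R) _ _ (_)
      (fun x => (1, x)) (Prod.map id (Quotient.mk R))
      continuous_coinduced_rng (Continuous.prodMk_right (1 : M))
  have hpair := @Continuous.prodMap _ _ _ _ _ (_) _ _ _ _ (continuous_id (X := M)) hone
  convert @Continuous.comp _ _ _ _ (_) (_) _ _ hact hpair using 1
  funext p
  simp
end
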